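/- For every extremal effect vector e there exist vectors e', f' ∈ ℝ^(X × A), both with all entries non-negative, such that ⟨e', P⟩ = ⟨e, P⟩ and ⟨f', P⟩ = 1 − ⟨e, P⟩ for every P ∈ S_NS, and such that e'(x,a)·f'(x,a) = 0 for every (x,a); that is, any extremal effect and its complement admit representations whose element-wise product is zero. -/

import Mathlib

open Finset

/-- The standard inner product on `ℝ^(X × A)`. -/
def ip {N nI nO : ℕ} (e P : (Fin N → Fin nI) → (Fin N → Fin nO) → ℝ) : ℝ :=
  ∑ x : Fin N → Fin nI, ∑ a : Fin N → Fin nO, e x a * P x a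

/-- The single-party no-signalling conditions. -/
def NoSig (N nI nO : ℕ) (P : (Fin N → Fin nI) → (Fin N → Fin nO) → ℝ) : Prop :=
  ∀ i : Fin N, ∀ x x' : Fin N → Fin nI, (∀ j, j ≠ i → x j = x' j) →
    ∀ a : Fin N → Fin nO,
      ∑ b : Fin nO, P x (Function.update a i b) =
      ∑ b : Fin nO, P x' (Function.update a i b)

/-- The state space of no-signalling behaviours. -/
def SNS (N nI nO : ℕ) (P : (Fin N → Fin nI) → (Fin N → Fin nO) → ℝ) : Prop :=
  NoSig N nI nO P ∧ (∀ x a, 0 ≤ P x a) ∧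
    (∀ x : Fin N → Fin nI, ∑ a : Fin N → Fin nO, P x a = 1)

/-- Effect vectors: `0 ≤ ⟨e, P⟩ ≤ 1` on all no-signalling states. -/
def IsEffect (N nI nO : ℕ) (e : (Fin N → Fin nI) → (Fin N → Fin nO) → ℝ) : Prop :=
  ∀ P, SNS N nI nO P → 0 ≤ ip e P ∧ ip e P ≤ 1

/-- Extremal effect vectors. -/
def IsExtremalEffect (N nI nO : ℕ) (e : (Fin N → Fin nI) → (Fin N → Fin nO) → ℝ) : Prop :=
  IsEffect N nI nO e ∧
  ∀ e₁ e₂ : (Fin N → Fin nI) → (Fin N → Fin nO) → ℝ, ∀ α : ℝ,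
    IsEffect N nI nO e₁ → IsEffect N nI nO e₂ → 0 < α → α < 1 →
    (∀ P, SNS N nI nO P → ip e P = α * ip e₁ P + (1 - α) * ip e₂ P) →
    (∀ P, SNS N nI nO P → ip e₁ P = ip e P ∧ ip e₂ P = ip e P)

lemma ip_add_left {N nI nO : ℕ} (e f P : (Fin N → Fin nI) → (Fin N → Fin nO) → ℝ) :
    ip (e + f) P = ip e P + ip f P := by
  simp [ip, add_mul, Finset.sum_add_distrib]

lemma ip_sub_left {N nI nO : ℕ} (e f P : (Fin N → Fin nI) → (Fin N → Fin nO) → ℝ) :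
    ip (e - f) P = ip e P - ip f P := by
  simp [ip, sub_mul, Finset.sum_sub_distrib]

lemma ip_add_right {N nI nO : ℕ} (e P Q : (Fin N → Fin nI) → (Fin N → Fin nO) → ℝ) :
    ip e (P + Q) = ip e P + ip e Q := by
  simp [ip, mul_add, Finset.sum_add_distrib]

lemma ip_smul_right {N nI nO : ℕ} (e : (Fin N → Fin nI) → (Fin N → Fin nO) → ℝ) (c : ℝ)
    (P : (Fin N → Fin nI) → (Fin N → Fin nO) → ℝ) :
    ip e (c • P) = c * ip e P := by
  simp [ip, Finset.mul_sum, mul_left_comm]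

lemma ip_nonneg {N nI nO : ℕ} {e P : (Fin N → Fin nI) → (Fin N → Fin nO) → ℝ}
    (he : ∀ x a, 0 ≤ e x a) (hP : ∀ x a, 0 ≤ P x a) : 0 ≤ ip e P :=
  Finset.sum_nonneg fun x _ => Finset.sum_nonneg fun a _ => mul_nonneg (he x a) (hP x a)

/-- The subspace of behaviours satisfying the no-signalling conditions. -/
def noSigSubmodule (N nI nO : ℕ) :
    Submodule ℝ ((Fin N → Fin nI) → (Fin N → Fin nO) → ℝ) where
  carrier := {P | NoSig N nI nO P}
  add_mem' := fun {P Q} hP hQ i x x' h a => by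
    simp only [Pi.add_apply, Finset.sum_add_distrib, hP i x x' h a, hQ i x x' h a]
  zero_mem' := fun i x x' h a => by simp
  smul_mem' := fun c P hP i x x' h a => by
    simp only [Pi.smul_apply, ← Finset.smul_sum, hP i x x' h a]

/-- The functional `⟨e, ·⟩`. -/
def ipLinear {N nI nO : ℕ} (e : (Fin N → Fin nI) → (Fin N → Fin nO) → ℝ) :
    ((Fin N → Fin nI) → (Fin N → Fin nO) → ℝ) →ₗ[ℝ] ℝ where
  toFun := ip e
  map_add' := ip_add_right e
  map_smul' := ip_smul_right e

/-- The cone of entrywise nonnegative vectors. -/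
def nonnegCone (N nI nO : ℕ) :
    PointedCone ℝ ((Fin N → Fin nI) → (Fin N → Fin nO) → ℝ) where
  carrier := {P | ∀ x a, 0 ≤ P x a}
  smul_mem' := fun c _ hP x a => mul_nonneg c.2 (hP x a)
  zero_mem' := fun _ _ => le_rfl
  add_mem' := fun hP hQ x a => add_nonneg (hP x a) (hQ x a)

lemma sum_sum_update {N nO : ℕ} (i : Fin N) (h : (Fin N → Fin nO) → ℝ) :
    ∑ a, ∑ b, h (Function.update a i b) = nO * ∑ a, h a := by
  have hinv : Function.Involutive
      (fun p : (Fin N → Fin nO) × Fin nO => (Function.update p.1 i p.2, p.1 i)) := by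
    rintro ⟨a, b⟩
    simp
  rw [← Fintype.sum_prod_type']
  rw [Fintype.sum_equiv hinv.toPerm (fun p : (Fin N → Fin nO) × Fin nO =>
    h (Function.update p.1 i p.2)) (fun p => h p.1) (fun p => rfl)]
  rw [Fintype.sum_prod_type]
  simp [Finset.mul_sum]

lemma NoSig.sum_eq {N nI nO : ℕ} (hO : 0 < nO)
    {P : (Fin N → Fin nI) → (Fin N → Fin nO) → ℝ} (hP : NoSig N nI nO P)
    (x x' : Fin N → Fin nI) : ∑ a, P x a = ∑ a, P x' a := by
  have step : ∀ i (x x' : Fin N → Fin nI), (∀ j, j ≠ i → x j = x' j) →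
      ∑ a, P x a = ∑ a, P x' a := by
    intro i x x' h
    have key := Finset.sum_congr rfl fun (a : Fin N → Fin nO) (_ : a ∈ Finset.univ) =>
      hP i x x' h a
    rw [sum_sum_update, sum_sum_update] at key
    exact mul_left_cancel₀ (by exact_mod_cast hO.ne') key
  have main : ∀ s : Finset (Fin N), ∑ a, P (s.piecewise x x') a = ∑ a, P x' a := by
    intro s
    induction s using Finset.induction_on with
    | empty => simp
    | insert i s _ ih =>
      rw [← ih]
      refine step i _ _ fun j hj => ?_
      simp [Finset.piecewise, hj]
  simpa using main Finset.univ

lemma ip_nonneg_of_noSig {N nI nO : ℕ} (hI : 0 < nI) (hO : 0 < nO)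
    {e : (Fin N → Fin nI) → (Fin N → Fin nO) → ℝ} (he : ∀ P, SNS N nI nO P → 0 ≤ ip e P)
    {P : (Fin N → Fin nI) → (Fin N → Fin nO) → ℝ} (hP : NoSig N nI nO P)
    (hpos : ∀ x a, 0 ≤ P x a) : 0 ≤ ip e P := by
  let x₀ : Fin N → Fin nI := fun _ => ⟨0, hI⟩
  have hc : ∀ x, ∑ a, P x a = ∑ a, P x₀ a := fun x => hP.sum_eq hO x x₀
  obtain ⟨c, hc₀⟩ : ∃ c, c = ∑ a, P x₀ a := ⟨_, rfl⟩
  rw [← hc₀] at hc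
  have hc_nonneg : 0 ≤ c := hc₀ ▸ Finset.sum_nonneg fun a _ => hpos x₀ a
  rcases hc_nonneg.eq_or_lt with h0 | hcpos
  · have hzero : ∀ x a, P x a = 0 := fun x a =>
      (Finset.sum_eq_zero_iff_of_nonneg fun a _ => hpos x a).1 ((hc x).trans h0.symm) a
        (Finset.mem_univ a)
    simp [ip, hzero]
  · have hS : SNS N nI nO (c⁻¹ • P) := by
      refine ⟨(noSigSubmodule N nI nO).smul_mem c⁻¹ hP, fun x a => ?_, fun x => ?_⟩
      · exact mul_nonneg (inv_nonneg.2 hcpos.le) (hpos x a)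
      · simp only [Pi.smul_apply, smul_eq_mul, ← Finset.mul_sum, hc x]
        exact inv_mul_cancel₀ hcpos.ne'
    have h := he _ hS
    rw [ip_smul_right] at h
    exact nonneg_of_mul_nonneg_right h (inv_pos.2 hcpos)

/-- A functional that is nonnegative on all states has an entrywise nonnegative representation. -/
lemma exists_nonneg_representation {N nI nO : ℕ} (hI : 0 < nI) (hO : 0 < nO)
    {e : (Fin N → Fin nI) → (Fin N → Fin nO) → ℝ} (he : ∀ P, SNS N nI nO P → 0 ≤ ip e P) :
    ∃ e' : (Fin N → Fin nI) → (Fin N → Fin nO) → ℝ,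
      (∀ x a, 0 ≤ e' x a) ∧ ∀ P, SNS N nI nO P → ip e' P = ip e P := by
  obtain ⟨g, hge, hg⟩ := riesz_extension (nonnegCone N nI nO)
    ⟨noSigSubmodule N nI nO, (ipLinear e).comp (noSigSubmodule N nI nO).subtype⟩
    (fun P hP => ip_nonneg_of_noSig hI hO he P.2 hP)
    (fun y => by
      refine ⟨⟨fun _ _ => ∑ x, ∑ a, |y x a|, fun i x x' _ a => rfl⟩, fun x a => ?_⟩
      have h : |y x a| ≤ ∑ x, ∑ a, |y x a| :=
        (Finset.single_le_sum (f := fun a => |y x a|) (fun a _ => abs_nonneg _)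
          (Finset.mem_univ a)).trans
        (Finset.single_le_sum (f := fun x => ∑ a, |y x a|)
          (fun x _ => Finset.sum_nonneg fun a _ => abs_nonneg _) (Finset.mem_univ x))
      change 0 ≤ (∑ x, ∑ a, |y x a|) + y x a
      linarith [neg_abs_le (y x a)])
  refine ⟨fun x a => g (Pi.single x (Pi.single a 1)), fun x a => hg _ fun x' a' => ?_,
    fun P hP => ?_⟩
  · simp only [Pi.single_apply]
    split_ifs <;> simp [Pi.single_apply]
    split_ifs <;> simp
  · refine Eq.trans ?_ (hge ⟨P, hP.1⟩)
    have hsum : P = ∑ x, ∑ a, P x a • Pi.single x (Pi.single a (1 : ℝ)) := by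
      ext x a
      simp [Finset.sum_apply, Pi.single_apply, ite_apply]
    change _ = g P
    conv_rhs => rw [hsum]
    simp [ip, map_sum, mul_comm]

theorem extremal_effect_orthogonal_complement_representation (N nI nO : ℕ)
    (hN : 0 < N) (hI : 0 < nI) (hO : 0 < nO)
    (e : (Fin N → Fin nI) → (Fin N → Fin nO) → ℝ)
    (he : IsExtremalEffect N nI nO e) :
    ∃ e' f' : (Fin N → Fin nI) → (Fin N → Fin nO) → ℝ,
      (∀ x a, 0 ≤ e' x a) ∧ (∀ x a, 0 ≤ f' x a) ∧
      (∀ P, SNS N nI nO P → ip e' P = ip e P) ∧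
      (∀ P, SNS N nI nO P → ip f' P = 1 - ip e P) ∧
      (∀ x a, e' x a * f' x a = 0) := by
  have hu : ∀ P, SNS N nI nO P →
      ip (fun _ _ => (Fintype.card (Fin N → Fin nI) : ℝ)⁻¹) P = 1 := by
    intro P hP
    have : Nonempty (Fin N → Fin nI) := ⟨fun _ => ⟨0, hI⟩⟩
    have hcard : (Fintype.card (Fin N → Fin nI) : ℝ) ≠ 0 :=
      Nat.cast_ne_zero.2 Fintype.card_ne_zero
    simp only [ip, ← Finset.mul_sum, hP.2.2, Finset.sum_const, Finset.card_univ, nsmul_eq_mul,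
      mul_one]
    exact mul_inv_cancel₀ hcard
  obtain ⟨p, hp, hpe⟩ := exists_nonneg_representation hI hO fun P hP => (he.1 P hP).1
  obtain ⟨q, hq, hqe⟩ := exists_nonneg_representation hI hO
    (e := (fun _ _ => (Fintype.card (Fin N → Fin nI) : ℝ)⁻¹) - e) fun P hP => by
      rw [ip_sub_left, hu P hP]
      linarith [(he.1 P hP).2]
  replace hqe : ∀ P, SNS N nI nO P → ip q P = 1 - ip e P := fun P hP => by
    rw [hqe P hP, ip_sub_left, hu P hP]
  let m : (Fin N → Fin nI) → (Fin N → Fin nO) → ℝ := fun x a => min (p x a) (q x a)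
  have hm : ∀ x a, 0 ≤ m x a := fun x a => le_min (hp x a) (hq x a)
  have hpm : ∀ x a, 0 ≤ (p - m) x a := fun x a => sub_nonneg.2 (min_le_left _ _)
  have hqm : ∀ x a, 0 ≤ (q - m) x a := fun x a => sub_nonneg.2 (min_le_right _ _)
  have hbounds : ∀ P, SNS N nI nO P → 0 ≤ ip m P ∧ ip m P ≤ ip e P ∧ ip m P ≤ 1 - ip e P := by
    intro P hP
    have h₁ := ip_nonneg hpm hP.2.1
    have h₂ := ip_nonneg hqm hP.2.1
    rw [ip_sub_left, hpe P hP] at h₁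
    rw [ip_sub_left, hqe P hP] at h₂
    exact ⟨ip_nonneg hm hP.2.1, by linarith, by linarith⟩
  have hm_zero : ∀ P, SNS N nI nO P → ip m P = 0 := by
    intro P hP
    have h := (he.2 (e + m) (e - m) (1 / 2)
      (fun Q hQ => by
        obtain ⟨h₁, h₂, h₃⟩ := hbounds Q hQ
        rw [ip_add_left]
        constructor <;> linarith)
      (fun Q hQ => by
        obtain ⟨h₁, h₂, h₃⟩ := hbounds Q hQ
        rw [ip_sub_left]
        constructor <;> linarith)
      (by norm_num) (by norm_num)
      (fun Q _ => by rw [ip_add_left, ip_sub_left]; ring) P hP).1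
    rw [ip_add_left] at h
    linarith
  refine ⟨p - m, q - m, hpm, hqm, fun P hP => ?_, fun P hP => ?_, fun x a => ?_⟩
  · rw [ip_sub_left, hm_zero P hP, hpe P hP, sub_zero]
  · rw [ip_sub_left, hm_zero P hP, hqe P hP, sub_zero]
  · change (p x a - min (p x a) (q x a)) * (q x a - min (p x a) (q x a)) = 0
    rcases le_total (p x a) (q x a) with h | h <;> simp [h]
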